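/- Let a ≥ 2 be an integer and let β be the unique real root greater than 1 of the polynomial P(X) = X^3 − aX^2 − X + 1. Then L_⊗(β) ≥ 3; more precisely, there exist x, y ∈ ℤ_β with x·y ∈ fin(β) but β^2·(x·y) ∉ ℤ_β. -/

import Mathlib

open Polynomial

/-- The β-transformation `T_β(x) = βx - ⌊βx⌋`. -/
noncomputable def betaT (β : ℝ) : ℝ → ℝ := fun x => β * x - ⌊β * x⌋

/-- `fin(β)`: reals `x` such that `|x|/β^N ∈ [0,1)` and the greedy expansion of
`|x|/β^N` is finite, for some `N, n ∈ ℕ`. -/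
def finBeta (β : ℝ) : Set ℝ :=
  {x | ∃ N n : ℕ, |x| / β ^ N ∈ Set.Ico (0 : ℝ) 1 ∧ (betaT β)^[n] (|x| / β ^ N) = 0}

/-- `ℤ_β`: the set of β-integers. -/
def betaInt (β : ℝ) : Set ℝ :=
  {x | ∃ N : ℕ, |x| / β ^ N ∈ Set.Ico (0 : ℝ) 1 ∧ (betaT β)^[N] (|x| / β ^ N) = 0}

/-- `L_⊕(β)`: the least `L ∈ ℕ` such that `β^L·(x+y) ∈ ℤ_β` for all
`x, y ∈ ℤ_β` with `x + y ∈ fin(β)`. -/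
noncomputable def Lplus (β : ℝ) : ℕ :=
  sInf {L : ℕ | ∀ x ∈ betaInt β, ∀ y ∈ betaInt β,
    x + y ∈ finBeta β → β ^ L * (x + y) ∈ betaInt β}

/-- `L_⊗(β)`: the least `L ∈ ℕ` such that `β^L·(x·y) ∈ ℤ_β` for all
`x, y ∈ ℤ_β` with `x·y ∈ fin(β)`. -/
noncomputable def Lmul (β : ℝ) : ℕ :=
  sInf {L : ℕ | ∀ x ∈ betaInt β, ∀ y ∈ betaInt β,
    x * y ∈ finBeta β → β ^ L * (x * y) ∈ betaInt β}

/-- The polynomial `X³ - aX² - X + 1`. -/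
noncomputable def cubicPoly (a : ℤ) : ℤ[X] := X ^ 3 - C a * X ^ 2 - X + 1

lemma aeval_cubicPoly (a : ℤ) (t : ℝ) :
    aeval t (cubicPoly a) = t ^ 3 - (a : ℝ) * t ^ 2 - t + 1 := by
  simp [cubicPoly]

lemma natDegree_cubicPoly (a : ℤ) : (cubicPoly a).natDegree = 3 := by
  unfold cubicPoly; compute_degree!

lemma monic_cubicPoly (a : ℤ) : (cubicPoly a).Monic := by
  unfold cubicPoly; monicity!

lemma irreducible_cubicPoly {a : ℤ} (ha : 2 ≤ a) : Irreducible (cubicPoly a) := by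
  have hd := natDegree_cubicPoly a
  rw [(monic_cubicPoly a).irreducible_iff_roots_eq_zero_of_degree_le_three
    (by omega) (by omega)]
  refine Multiset.eq_zero_of_forall_notMem fun r hr => ?_
  have h : r ^ 3 - a * r ^ 2 - r + 1 = 0 := by
    simpa [cubicPoly] using isRoot_of_mem_roots hr
  have hu : r ∣ 1 := ⟨-(r ^ 2) + a * r + 1, by linear_combination h⟩
  rcases Int.isUnit_iff.1 (isUnit_of_dvd_one hu) with rfl | rfl <;> norm_num at h <;> omega

/-- Every integer polynomial vanishing at one real root of `X³ - aX² - X + 1` vanishes at all of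
them. -/
lemma aeval_eq_zero_of_cubicPoly_root {a : ℤ} (ha : 2 ≤ a) {β γ : ℝ}
    (hβ : aeval β (cubicPoly a) = 0) (hγ : aeval γ (cubicPoly a) = 0) {p : ℤ[X]}
    (hp : aeval β p = 0) : aeval γ p = 0 := by
  have hint : IsIntegral ℤ β := ⟨cubicPoly a, monic_cubicPoly a, hβ⟩
  have hdvd : minpoly ℤ β ∣ cubicPoly a := minpoly.isIntegrallyClosed_dvd hint hβ
  have hassoc : cubicPoly a ∣ minpoly ℤ β :=
    (((minpoly.prime_of_isIntegrallyClosed hint).irreducible).dvd_comm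
      (irreducible_cubicPoly ha)).1 hdvd
  obtain ⟨q, rfl⟩ := hassoc.trans (minpoly.isIntegrallyClosed_dvd hint hp)
  simp [hγ]

lemma betaT_eq_fract (β x : ℝ) : betaT β x = Int.fract (β * x) := rfl

lemma betaT_zero (β : ℝ) : betaT β 0 = 0 := by simp [betaT]

lemma betaT_iterate_zero (β : ℝ) (n : ℕ) : (betaT β)^[n] 0 = 0 :=
  Function.iterate_fixed (betaT_zero β) n

lemma betaT_iterate_mem_Ico (β : ℝ) (n : ℕ) {z : ℝ} (hz : z ∈ Set.Ico (0 : ℝ) 1) :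
    (betaT β)^[n] z ∈ Set.Ico (0 : ℝ) 1 := by
  cases n with
  | zero => simpa using hz
  | succ n =>
    rw [Function.iterate_succ_apply', betaT_eq_fract]
    exact ⟨Int.fract_nonneg _, Int.fract_lt_one _⟩

/-- Once an iterate of `betaT` vanishes, so do all later ones. -/
lemma betaT_iterate_eq_zero_of_le {β z : ℝ} {m n : ℕ} (hmn : m ≤ n)
    (h : (betaT β)^[m] z = 0) : (betaT β)^[n] z = 0 := by
  obtain ⟨k, rfl⟩ := Nat.exists_eq_add_of_le' hmn
  rw [Function.iterate_add_apply, h, betaT_iterate_zero]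

lemma betaT_iterate_div_pow {β z : ℝ} (hβ : 1 < β) (hz : z ∈ Set.Ico (0 : ℝ) 1) (k : ℕ) :
    (betaT β)^[k] (z / β ^ k) = z := by
  induction k with
  | zero => simp
  | succ k ih =>
    have hβ0 : β ≠ 0 := by positivity
    have hk : 1 ≤ β ^ k := one_le_pow₀ hβ.le
    have h : β * (z / β ^ (k + 1)) = z / β ^ k := by field_simp; ring
    rw [Function.iterate_succ_apply, betaT_eq_fract, h,
      Int.fract_eq_self.2 ⟨div_nonneg hz.1 (by positivity),
        (div_le_self hz.1 hk).trans_lt hz.2⟩, ih]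

lemma pow_mul_mem_betaInt {β x : ℝ} (hβ : 1 < β) (hx : x ∈ betaInt β) (k : ℕ) :
    β ^ k * x ∈ betaInt β := by
  obtain ⟨N, hmem, hN⟩ := hx
  have hβ0 : 0 < β := by positivity
  have h : |β ^ k * x| / β ^ (k + N) = |x| / β ^ N := by
    rw [abs_mul, abs_of_pos (pow_pos hβ0 k), pow_add]
    exact mul_div_mul_left _ _ (pow_pos hβ0 k).ne'
  exact ⟨k + N, h ▸ hmem, by rw [h]; exact betaT_iterate_eq_zero_of_le (by omega) hN⟩

/-- Whether `x` is a `β`-integer can be tested at any admissible exponent. -/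
lemma betaT_iterate_eq_zero_of_mem_betaInt {β x : ℝ} (hβ : 1 < β) (hx : x ∈ betaInt β) {M : ℕ}
    (hM : |x| / β ^ M ∈ Set.Ico (0 : ℝ) 1) : (betaT β)^[M] (|x| / β ^ M) = 0 := by
  obtain ⟨N, hmem, hN⟩ := hx
  rcases le_total M N with h | h <;> obtain ⟨k, rfl⟩ := Nat.exists_eq_add_of_le h
  · rwa [Function.iterate_add_apply, pow_add, ← div_div, betaT_iterate_div_pow hβ hM] at hN
  · rwa [Function.iterate_add_apply, pow_add, ← div_div, betaT_iterate_div_pow hβ hmem]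

/-- `n` steps of the greedy algorithm at `β`, with the digit polynomial `p` evaluated also at
`γ ∈ (0,1)`. -/
lemma exists_digit_polynomial {a : ℤ} {β γ : ℝ} (hβ : 1 < β) (hβa : β < a + 1) (hγ0 : 0 < γ)
    (hγ1 : γ < 1) (n : ℕ) {z : ℝ} (hz : z ∈ Set.Ico (0 : ℝ) 1) :
    ∃ p : ℤ[X], aeval β p + (betaT β)^[n] z = β ^ n * z ∧
      0 ≤ aeval γ p ∧ aeval γ p ≤ a / (1 - γ) := by
  have hγ : 0 < 1 - γ := by linarith
  induction n with
  | zero =>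
    refine ⟨0, by simp, by simp, ?_⟩
    have : (0 : ℝ) < a := by linarith
    simp only [map_zero]
    positivity
  | succ n ih =>
    obtain ⟨p, hp, h0, h1⟩ := ih
    obtain ⟨ht0, ht1⟩ := betaT_iterate_mem_Ico β n hz
    rw [Function.iterate_succ_apply']
    set t := (betaT β)^[n] z
    have hd0 : 0 ≤ ⌊β * t⌋ := Int.floor_nonneg.2 (by positivity)
    have hda : ⌊β * t⌋ ≤ a := by
      refine Int.lt_add_one_iff.1 (Int.floor_lt.2 ?_)
      push_cast
      nlinarith
    have hd0' : (0 : ℝ) ≤ ⌊β * t⌋ := by exact_mod_cast hd0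
    have hda' : (⌊β * t⌋ : ℝ) ≤ a := by exact_mod_cast hda
    refine ⟨X * p + C ⌊β * t⌋, ?_, ?_, ?_⟩
    · simp only [betaT, map_add, map_mul, aeval_X, eq_intCast, map_intCast]
      linear_combination β * hp
    · simp
      positivity
    · simp
      have : γ * (a / (1 - γ)) + a = a / (1 - γ) := by field_simp; ring
      nlinarith [mul_le_mul_of_nonneg_left h1 hγ0.le]

/-- The set defining `Lmul β` is nonempty. -/
lemma exists_Lmul_bound {a : ℤ} (ha : 2 ≤ a) {β : ℝ} (hβ : 1 < β) (hβa : β < a + 1)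
    (hroot : β ^ 3 - (a : ℝ) * β ^ 2 - β + 1 = 0) :
    ∃ L : ℕ, ∀ x ∈ betaInt β, ∀ y ∈ betaInt β,
      x * y ∈ finBeta β → β ^ L * (x * y) ∈ betaInt β := by
  have ha' : (2 : ℝ) ≤ a := by exact_mod_cast ha
  have hβ0 : 0 < β := by positivity
  obtain ⟨γ, ⟨hγ0, hγ1⟩, hγ⟩ : ∃ γ ∈ Set.Ioo (0 : ℝ) 1, γ ^ 3 - (a : ℝ) * γ ^ 2 - γ + 1 = 0 := by
    have hc : ContinuousOn (fun t : ℝ => t ^ 3 - (a : ℝ) * t ^ 2 - t + 1) (Set.Icc 0 1) := by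
      fun_prop
    refine intermediate_value_Ioo' zero_le_one hc ⟨?_, ?_⟩ <;> norm_num
    linarith
  have hγ' : 0 < 1 - γ := by linarith
  have hconj {p q : ℤ[X]} (h : aeval β p = aeval β q) : aeval γ p = aeval γ q := by
    have := aeval_eq_zero_of_cubicPoly_root ha (γ := γ) (p := p - q)
      ((aeval_cubicPoly a β).trans hroot) ((aeval_cubicPoly a γ).trans hγ) (by simp [h])
    simpa [sub_eq_zero] using this
  set K : ℝ := a / (1 - γ)
  have hK : 0 < K := div_pos (by linarith) hγ'
  obtain ⟨L, hL⟩ := exists_pow_lt_of_lt_one (show 0 < 1 / (K * K) by positivity) hγ1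
  refine ⟨L, ?_⟩
  rintro x ⟨N₁, hx, hxN⟩ y ⟨N₂, hy, hyN⟩ ⟨N, n, hxy, hn⟩
  obtain ⟨p, hp, -, hpK⟩ := exists_digit_polynomial hβ hβa hγ0 hγ1 N₁ hx
  obtain ⟨q, hq, hq0, hqK⟩ := exists_digit_polynomial hβ hβa hγ0 hγ1 N₂ hy
  rw [hxN, mul_div_cancel₀ _ (by positivity), add_zero] at hp
  rw [hyN, mul_div_cancel₀ _ (by positivity), add_zero] at hq
  set z := |x * y| / β ^ N with hz
  have hzN : β ^ N * z = |x * y| := mul_div_cancel₀ _ (by positivity)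
  suffices h : (betaT β)^[L + N] z = 0 by
    have h' : |β ^ L * (x * y)| / β ^ (L + N) = z := by
      rw [abs_mul, abs_of_pos (pow_pos hβ0 L), pow_add, hz]
      exact mul_div_mul_left _ _ (pow_pos hβ0 L).ne'
    exact ⟨L + N, h' ▸ hxy, by rw [h', h]⟩
  have hex : ∃ n, (betaT β)^[n] z = 0 := ⟨n, hn⟩
  classical
  by_contra hcon
  have hlt : L + N < Nat.find hex := by
    by_contra! hle
    exact hcon (betaT_iterate_eq_zero_of_le hle (Nat.find_spec hex))
  obtain ⟨k, hk⟩ := Nat.exists_eq_add_of_lt hlt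
  have hzero := Nat.find_spec hex
  have hne := Nat.find_min hex (m := L + N + k) (by omega)
  rw [hk, Function.iterate_succ_apply'] at hzero
  obtain ⟨r, hr, hr0, -⟩ := exists_digit_polynomial hβ hβa hγ0 hγ1 (L + N + k) hxy
  obtain ⟨ht0, ht1⟩ := betaT_iterate_mem_Ico β (L + N + k) hxy
  set t := (betaT β)^[L + N + k] z
  have hd : β * t = ⌊β * t⌋ := sub_eq_zero.1 hzero
  have hd1 : (1 : ℝ) ≤ ⌊β * t⌋ := by
    have : (0 : ℝ) < ⌊β * t⌋ := hd ▸ mul_pos hβ0 (lt_of_le_of_ne ht0 (Ne.symm hne))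
    exact_mod_cast this
  have key := hconj (p := X * r + C ⌊β * t⌋) (q := X ^ (L + k + 1) * (p * q)) (by
    simp only [map_add, map_mul, map_pow, aeval_X, hp, hq, ← abs_mul]
    simp only [eq_intCast, map_intCast]
    rw [← hzN, ← hd]
    linear_combination β * hr)
  simp only [map_add, map_mul, map_pow, aeval_X] at key
  simp only [eq_intCast, map_intCast] at key
  have h1 : aeval γ p * aeval γ q ≤ K * K := mul_le_mul hpK hqK hq0 hK.le
  have h2 : γ ^ (L + k + 1) ≤ γ ^ L := pow_le_pow_of_le_one hγ0.le hγ1.le (by omega)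
  have h3 : γ ^ (L + k + 1) * (aeval γ p * aeval γ q) ≤ γ ^ L * (K * K) :=
    (mul_le_mul_of_nonneg_left h1 (by positivity)).trans
      (mul_le_mul_of_nonneg_right h2 (by positivity))
  rw [lt_div_iff₀ (by positivity)] at hL
  nlinarith [mul_nonneg hγ0.le hr0]

/-- The value `∑ dᵢ β⁻ⁱ` of a finite digit string `d₁ d₂ …`. -/
noncomputable def digitValue (β : ℝ) : List ℤ → ℝ
  | [] => 0
  | d :: l => (d + digitValue β l) / β

/-- A finite digit string all of whose suffixes have value in `[0,1)`. -/
def IsGreedy (β : ℝ) (l : List ℤ) : Prop :=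
  ∀ s, s <:+ l → digitValue β s ∈ Set.Ico (0 : ℝ) 1

lemma isGreedy_nil (β : ℝ) : IsGreedy β [] := by
  intro s hs
  rw [List.suffix_nil.1 hs]
  simp [digitValue]

lemma IsGreedy.mem {β : ℝ} {l : List ℤ} (h : IsGreedy β l) :
    digitValue β l ∈ Set.Ico (0 : ℝ) 1 := h l List.suffix_rfl

lemma IsGreedy.cons {β : ℝ} {l : List ℤ} (hβ : 1 < β) (h : IsGreedy β l) {d : ℤ} (hd : 0 ≤ d)
    (hlt : d + digitValue β l < β) : IsGreedy β (d :: l) := by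
  intro s hs
  rcases List.suffix_cons_iff.1 hs with rfl | hs
  · have hd' : (0 : ℝ) ≤ d := by exact_mod_cast hd
    have := h.mem.1
    exact ⟨div_nonneg (by positivity) (by positivity), (div_lt_one (by positivity)).2 hlt⟩
  · exact h s hs

/-- A digit smaller than some integer `a ≤ β` may always be prepended. -/
lemma IsGreedy.cons_of_lt {β : ℝ} {l : List ℤ} (hβ : 1 < β) {a : ℤ} (haβ : a ≤ β)
    (h : IsGreedy β l) {d : ℤ} (hd : 0 ≤ d) (hda : d < a) : IsGreedy β (d :: l) := by
  have : (d : ℝ) + 1 ≤ a := by exact_mod_cast hda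
  exact h.cons hβ hd (by linarith [h.mem.2])

lemma betaT_digitValue {β : ℝ} (hβ : 1 < β) {d : ℤ} {l : List ℤ} (h : IsGreedy β (d :: l)) :
    betaT β (digitValue β (d :: l)) = digitValue β l := by
  have hβ0 : β ≠ 0 := by positivity
  rw [betaT_eq_fract, digitValue, mul_div_cancel₀ _ hβ0, Int.fract_intCast_add]
  exact Int.fract_eq_self.2 (h l (List.suffix_cons d l))

lemma betaT_iterate_digitValue {β : ℝ} (hβ : 1 < β) {l : List ℤ} (h : IsGreedy β l) (n : ℕ) :
    (betaT β)^[n] (digitValue β l) = digitValue β (l.drop n) := by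
  induction n generalizing l with
  | zero => simp
  | succ n ih =>
    cases l with
    | nil => simp [digitValue, betaT_iterate_zero]
    | cons d l =>
      rw [Function.iterate_succ_apply, betaT_digitValue hβ h,
        ih fun s hs => h s (hs.trans (List.suffix_cons d l)), List.drop_succ_cons]

lemma IsGreedy.pow_mul_abs_div {β : ℝ} (hβ : 1 < β) {l : List ℤ} (h : IsGreedy β l) (n : ℕ) :
    |β ^ n * digitValue β l| / β ^ n = digitValue β l := by
  have hβ0 : 0 < β := by positivity
  rw [abs_of_nonneg (mul_nonneg (by positivity) h.mem.1),
    mul_div_cancel_left₀ _ (pow_pos hβ0 n).ne']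

lemma IsGreedy.pow_mul_mem_betaInt {β : ℝ} (hβ : 1 < β) {l : List ℤ} (h : IsGreedy β l) :
    β ^ l.length * digitValue β l ∈ betaInt β := by
  refine ⟨l.length, ?_, ?_⟩ <;> rw [h.pow_mul_abs_div hβ]
  · exact h.mem
  · rw [betaT_iterate_digitValue hβ h, List.drop_length, digitValue]

lemma IsGreedy.pow_mul_mem_finBeta {β : ℝ} (hβ : 1 < β) {l : List ℤ} (h : IsGreedy β l) (n : ℕ) :
    β ^ n * digitValue β l ∈ finBeta β := by
  refine ⟨n, l.length, ?_, ?_⟩ <;> rw [h.pow_mul_abs_div hβ]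
  · exact h.mem
  · rw [betaT_iterate_digitValue hβ h, List.drop_length, digitValue]

/-- A greedy digit string whose tail after position `n` has nonzero value is not the expansion of
a `β`-integer with `n` integer digits. -/
lemma IsGreedy.pow_mul_notMem_betaInt {β : ℝ} (hβ : 1 < β) {l : List ℤ} (h : IsGreedy β l) {n : ℕ}
    (hn : digitValue β (l.drop n) ≠ 0) : β ^ n * digitValue β l ∉ betaInt β := by
  intro hmem
  have := betaT_iterate_eq_zero_of_mem_betaInt hβ hmem (M := n)
    (by rw [h.pow_mul_abs_div hβ]; exact h.mem)
  rw [h.pow_mul_abs_div hβ, betaT_iterate_digitValue hβ h] at this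
  exact hn this

/-- It suffices to multiply two greedy digit strings into a string with exactly three fractional
digits. -/
lemma exists_product_of_digits {β : ℝ} (hβ : 1 < β) {u v w : List ℤ} (hu : IsGreedy β u)
    (hv : IsGreedy β v) (hw : IsGreedy β w) {n : ℕ}
    (hn : digitValue β (w.drop (2 + n)) ≠ 0)
    (huv : (β ^ u.length * digitValue β u) * (β ^ v.length * digitValue β v) =
      β ^ n * digitValue β w) :
    ∃ x ∈ betaInt β, ∃ y ∈ betaInt β, x * y ∈ finBeta β ∧ β ^ 2 * (x * y) ∉ betaInt β := by
  refine ⟨_, hu.pow_mul_mem_betaInt hβ, _, hv.pow_mul_mem_betaInt hβ, ?_, ?_⟩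
  · rw [huv]
    exact hw.pow_mul_mem_finBeta hβ n
  · rw [huv, ← mul_assoc, ← pow_add]
    exact hw.pow_mul_notMem_betaInt hβ hn

theorem exists_product_of_eq_two {β : ℝ} (hβ : 1 < β) (hβ2 : 2 < β)
    (hroot : β ^ 3 - 2 * β ^ 2 - β + 1 = 0) :
    ∃ x ∈ betaInt β, ∃ y ∈ betaInt β, x * y ∈ finBeta β ∧ β ^ 2 * (x * y) ∉ betaInt β := by
  have hβ0 : β ≠ 0 := by positivity
  have h2 : ((2 : ℤ) : ℝ) ≤ β := by push_cast; exact hβ2.le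
  have small {l : List ℤ} (h : IsGreedy β l) {d : ℤ} (h0 : 0 ≤ d) (h1 : d < 2) :
      IsGreedy β (d :: l) := h.cons_of_lt hβ h2 h0 h1
  have hu : IsGreedy β [1, 0, 1, 2] := by
    refine small (small (small ((isGreedy_nil β).cons hβ ?_ ?_) ?_ ?_) ?_ ?_) ?_ ?_ <;>
      norm_num [digitValue]
    exact hβ2
  have ht : IsGreedy β [0, 1, 0, 1, 0, 0, 1] := by
    refine small (small (small (small (small (small (small (isGreedy_nil β)
      ?_ ?_) ?_ ?_) ?_ ?_) ?_ ?_) ?_ ?_) ?_ ?_) ?_ ?_ <;> norm_num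
  have hw : IsGreedy β [1, 1, 2, 0, 1, 0, 1, 0, 0, 1] := by
    refine small (small (ht.cons hβ ?_ ?_) ?_ ?_) ?_ ?_ <;> norm_num [digitValue]
    field_simp
    have h : β ^ 8 - (2 * β ^ 7 + (β ^ 5 + (β ^ 3 + 1))) = β * (β - 2) + (β - 1) := by
      linear_combination (β ^ 5 + β ^ 3 + β) * hroot
    nlinarith [mul_pos (zero_lt_one.trans hβ) (sub_pos.2 hβ2)]
  refine exists_product_of_digits hβ hu hu hw (n := 7) (by simp [digitValue, hβ0]) ?_
  simp only [digitValue, List.length]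
  push_cast
  field_simp
  linear_combination (-1 - β - 3 * β ^ 2 - β ^ 3 - 2 * β ^ 4 - β ^ 5) * hroot

theorem exists_product_of_three_le {a : ℤ} (ha : 3 ≤ a) {β : ℝ} (hβ : 1 < β) (haβ : a < β)
    (hroot : β ^ 3 - (a : ℝ) * β ^ 2 - β + 1 = 0) :
    ∃ x ∈ betaInt β, ∃ y ∈ betaInt β, x * y ∈ finBeta β ∧ β ^ 2 * (x * y) ∉ betaInt β := by
  have hβ0 : β ≠ 0 := by positivity
  have small {l : List ℤ} (h : IsGreedy β l) {d : ℤ} (h0 : 0 ≤ d) (h1 : d < a) :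
      IsGreedy β (d :: l) := h.cons_of_lt hβ haβ.le h0 h1
  have hu : IsGreedy β [a - 1, 0, a - 1, a - 1] := by
    refine small (small (small (small (isGreedy_nil β) ?_ ?_) ?_ ?_) ?_ ?_) ?_ ?_ <;> omega
  have hv : IsGreedy β [a - 1, a - 1, a] := by
    refine small (small ((isGreedy_nil β).cons hβ ?_ ?_) ?_ ?_) ?_ ?_
    case refine_2 => simpa [digitValue] using haβ
    all_goals omega
  have ht : IsGreedy β [0, a - 3, 1] := by
    refine small (small (small (isGreedy_nil β) ?_ ?_) ?_ ?_) ?_ ?_ <;> omega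
  have hw : IsGreedy β [a - 1, 0, 0, a - 2, 1, 0, a, 0, a - 3, 1] := by
    refine small (small (small (small (small (small (ht.cons hβ ?_ ?_) ?_ ?_) ?_ ?_) ?_ ?_)
      ?_ ?_) ?_ ?_) ?_ ?_
    case refine_2 =>
      simp only [digitValue]
      push_cast
      field_simp
      have h : β ^ 4 - (a * β ^ 3 + (0 * β ^ 2 + ((a - 3) * β + (1 + 0)))) =
          β * (β - a) + (2 * β - 1) := by
        linear_combination β * hroot
      nlinarith [mul_pos (zero_lt_one.trans hβ) (sub_pos.2 haβ)]
    all_goals omega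
  refine exists_product_of_digits hβ hu hv hw (n := 7) (by simp [digitValue, hβ0]) ?_
  simp only [digitValue, List.length]
  push_cast
  field_simp
  linear_combination (-1 + (2 - a) * β + (2 - 2 * a) * β ^ 2 + (3 - 2 * a) * β ^ 3 +
    (2 - 2 * a) * β ^ 4 + (1 - a) * β ^ 5 + (1 - a) * β ^ 6) * hroot

theorem stmt13 (a : ℤ) (ha : 2 ≤ a) (β : ℝ) (hβ : 1 < β)
    (hroot : β ^ 3 - (a : ℝ) * β ^ 2 - β + 1 = 0) :
    3 ≤ Lmul β ∧
    ∃ x ∈ betaInt β, ∃ y ∈ betaInt β,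
      x * y ∈ finBeta β ∧ β ^ 2 * (x * y) ∉ betaInt β := by
  have ha' : (2 : ℝ) ≤ a := by exact_mod_cast ha
  have haβ : a < β := by nlinarith
  have hβa : β < a + 1 := by nlinarith
  have hex : ∃ x ∈ betaInt β, ∃ y ∈ betaInt β,
      x * y ∈ finBeta β ∧ β ^ 2 * (x * y) ∉ betaInt β := by
    rcases eq_or_lt_of_le ha with rfl | ha3
    · push_cast at haβ hroot
      exact exists_product_of_eq_two hβ haβ hroot
    · exact exists_product_of_three_le ha3 hβ haβ hroot
  refine ⟨?_, hex⟩
  obtain ⟨x, hx, y, hy, hfin, hnot⟩ := hex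
  refine le_csInf (exists_Lmul_bound ha hβ hβa hroot) fun L hL => ?_
  by_contra! hlt
  have h := pow_mul_mem_betaInt hβ (hL x hx y hy hfin) (2 - L)
  rw [← mul_assoc, ← pow_add, Nat.sub_add_cancel (by omega)] at h
  exact hnot h
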